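/- arXiv:2410.07424 — 4 statements merged into one kernel-verified Lean document; each statement's English description precedes it below -/
import Mathlib

section
/- Let X be a nonempty compact metric space, α : X → X a minimal homeomorphism, and Y ⊆ X a closed subset with non-empty interior. Then the set {r_Y(y) : y ∈ Y} of first return times to Y is finite; that is, there are only finitely many distinct first return times r_1 < r_2 < ⋯ < r_K to Y. -/
open Set

/-- A homeomorphism of a topological space is *minimal* if every (two-sided) orbit
`{α^n x : n ∈ ℤ}` is dense. -/
def IsMinimalHomeo {X : Type*} [TopologicalSpace X] (α : X ≃ₜ X) : Prop :=
  ∀ x : X, Dense (Set.range fun n : ℤ => (α.toEquiv ^ n) x)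

/-- The first return time of `x` to `Y` under `α`: the least `n ≥ 1` with `α^n x ∈ Y`
(the `sInf` of the empty set being `0` when no such `n` exists). -/
noncomputable def firstReturn {X : Type*} [TopologicalSpace X] (α : X ≃ₜ X) (Y : Set X)
    (x : X) : ℕ :=
  sInf {n : ℕ | 1 ≤ n ∧ (α.toEquiv ^ n) x ∈ Y}

/-- `returnSet α Y r = Y_r = {y ∈ Y | r_Y(y) = r}`. -/
def returnSet {X : Type*} [TopologicalSpace X] (α : X ≃ₜ X) (Y : Set X) (r : ℕ) : Set X :=
  {y : X | y ∈ Y ∧ firstReturn α Y y = r}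

theorem continuous_toEquiv_zpow {X : Type*} [TopologicalSpace X] (α : X ≃ₜ X) (n : ℤ) :
    Continuous ⇑(α.toEquiv ^ n) := by
  induction n with
  | zero => exact continuous_id
  | succ k ih =>
    rw [zpow_add_one, Equiv.Perm.coe_mul]
    exact ih.comp α.continuous
  | pred k ih =>
    rw [zpow_sub_one, Equiv.Perm.coe_mul]
    exact ih.comp α.symm.continuous

/-- Under a minimal homeomorphism of a compact space, the forward hitting times of a non-empty
open set are uniformly bounded. -/
theorem IsMinimalHomeo.exists_forall_pow_mem {X : Type*} [TopologicalSpace X] [CompactSpace X]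
    {α : X ≃ₜ X} (hmin : IsMinimalHomeo α) {U : Set X} (hU : IsOpen U) (hne : U.Nonempty) :
    ∃ M : ℕ, ∀ x : X, ∃ n : ℕ, 1 ≤ n ∧ n ≤ M ∧ (α.toEquiv ^ n) x ∈ U := by
  obtain ⟨t, ht⟩ := isCompact_univ.elim_finite_subcover
    (fun n : ℤ => ⇑(α.toEquiv ^ n) ⁻¹' U) (fun n => hU.preimage (continuous_toEquiv_zpow α n))
    (fun x _ => by
      obtain ⟨_, hy, n, rfl⟩ := (hmin x).inter_open_nonempty U hU hne
      exact mem_iUnion.2 ⟨n, hy⟩)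
  set N : ℕ := t.sup Int.natAbs
  refine ⟨2 * N + 1, fun x => ?_⟩
  obtain ⟨n, hn, hx⟩ := mem_iUnion₂.1 (ht (mem_univ ((α.toEquiv ^ ((N : ℤ) + 1)) x)))
  have hle : n.natAbs ≤ N := Finset.le_sup (f := Int.natAbs) hn
  rw [mem_preimage, ← Equiv.Perm.mul_apply, ← zpow_add] at hx
  obtain ⟨m, hm⟩ := Int.eq_ofNat_of_zero_le (show 0 ≤ n + ((N : ℤ) + 1) by omega)
  rw [hm, zpow_natCast] at hx
  exact ⟨m, by omega, by omega, hx⟩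

/-- the set of first return times `{r_Y(y) : y ∈ Y}` is finite. -/
theorem finite_return_times {X : Type*} [MetricSpace X] [CompactSpace X]
    [Nonempty X] (α : X ≃ₜ X) (hmin : IsMinimalHomeo α) (Y : Set X)
    (hYclosed : IsClosed Y) (hYint : (interior Y).Nonempty) :
    (firstReturn α Y '' Y).Finite := by
  obtain ⟨M, hM⟩ := hmin.exists_forall_pow_mem isOpen_interior hYint
  refine (finite_Iic M).subset ?_
  rintro _ ⟨x, -, rfl⟩
  obtain ⟨n, h1, hn, hx⟩ := hM x
  exact le_trans (Nat.sInf_le (And.intro h1 (interior_subset hx))) hn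
end

section
/- Let X be a nonempty compact metric space, α : X → X a minimal homeomorphism, and Y ⊆ X a closed subset with non-empty interior. Let r ≥ 1 and let x ∈ closure(Y_r) \ Y_r, where Y_r = {y ∈ Y : r_Y(y) = r}. Then x ∈ Y and r_Y(x) < r. -/
open Set

/-- Iterates of a homeomorphism are continuous. -/
theorem continuous_toEquiv_pow {X : Type*} [TopologicalSpace X] (α : X ≃ₜ X) (n : ℕ) :
    Continuous fun x : X => (α.toEquiv ^ n) x := by
  induction n with
  | zero => exact continuous_id
  | succ n ih =>
    simp only [pow_succ, Equiv.Perm.mul_apply]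
    exact ih.comp α.continuous

/-- A point with positive first return time `r` satisfies `α^r y ∈ Y`. -/
theorem pow_apply_mem_of_mem_returnSet {X : Type*} [TopologicalSpace X] {α : X ≃ₜ X}
    {Y : Set X} {r : ℕ} (hr : 1 ≤ r) {y : X} (hy : y ∈ returnSet α Y r) :
    (α.toEquiv ^ r) y ∈ Y := by
  obtain ⟨-, rfl⟩ := hy
  exact (Nat.sInf_mem (Nat.nonempty_of_pos_sInf hr)).2

/-- if `x ∈ closure(Y_r) \ Y_r` where `Y_r = {y ∈ Y : r_Y(y) = r}`, then
`x ∈ Y` and `r_Y(x) < r`. -/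
theorem boundary_point_strict_return {X : Type*} [MetricSpace X] [CompactSpace X]
    [Nonempty X] (α : X ≃ₜ X) (hmin : IsMinimalHomeo α) (Y : Set X)
    (hYclosed : IsClosed Y) (hYint : (interior Y).Nonempty)
    (r : ℕ) (hr : 1 ≤ r) (x : X) (hx : x ∈ closure (returnSet α Y r) \ returnSet α Y r) :
    x ∈ Y ∧ firstReturn α Y x < r := by
  have hxY : x ∈ Y := closure_minimal (fun _ hy => hy.1) hYclosed hx.1
  have hxr : (α.toEquiv ^ r) x ∈ Y :=
    closure_minimal (fun _ hy => pow_apply_mem_of_mem_returnSet hr hy)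
      (hYclosed.preimage (continuous_toEquiv_pow α r)) hx.1
  exact ⟨hxY, lt_of_le_of_ne (Nat.sInf_le ⟨hr, hxr⟩) fun h => hx.2 ⟨hxY, h⟩⟩
end

section
/- Let X be a nonempty compact metric space, α : X → X a minimal homeomorphism, and Y ⊆ X a closed subset with non-empty interior. Let r ≥ 1, let z ∈ closure(Y_r) where Y_r = {y ∈ Y : r_Y(y) = r}, let w ∈ Y, and let integers i, p satisfy 0 ≤ i < r and 0 ≤ p < r_Y(w). If α^i(z) = α^p(w), then i ≥ p. -/
open Set

/-- if `z ∈ closure(Y_r)`, `w ∈ Y`, `0 ≤ i < r`, `0 ≤ p < r_Y(w)` and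
`α^i z = α^p w`, then `i ≥ p`. -/
theorem tower_level_ge {X : Type*} [MetricSpace X] [CompactSpace X]
    [Nonempty X] (α : X ≃ₜ X) (hmin : IsMinimalHomeo α) (Y : Set X)
    (hYclosed : IsClosed Y) (hYint : (interior Y).Nonempty)
    (r : ℕ) (hr : 1 ≤ r) (z : X) (hz : z ∈ closure (returnSet α Y r))
    (w : X) (hw : w ∈ Y) (i p : ℕ) (hi : i < r) (hp : p < firstReturn α Y w)
    (heq : (α.toEquiv ^ i) z = (α.toEquiv ^ p) w) :
    p ≤ i := by
  have hzY : z ∈ Y := closure_minimal (fun _ hy => hy.1) hYclosed hz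
  by_contra! hip
  have hback : (α.toEquiv ^ (p - i)) w = z := by
    apply (α.toEquiv ^ i).injective
    rw [heq, ← Equiv.Perm.mul_apply, ← pow_add, Nat.add_sub_cancel' hip.le]
  have hle : firstReturn α Y w ≤ p - i :=
    Nat.sInf_le ⟨by omega, hback.symm ▸ hzY⟩
  omega
end

section
/- Let X be a nonempty compact metric space, α : X → X a minimal homeomorphism, and Y ⊆ X a subset that is both closed and open with non-empty interior (i.e. Y is a non-empty clopen set). Then for every integer r ≥ 1 the set Y_r = {y ∈ Y : r_Y(y) = r} is clopen in X, and Y_r is empty for all but finitely many r; consequently the Rokhlin tower sets α^i(Y_r) (r a first return time, 0 ≤ i < r) form a finite partition of X into clopen sets. -/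
open Set

/-- Passing from a homeomorphism to the underlying permutation commutes with integer powers. -/
theorem toEquiv_zpow {X : Type*} [TopologicalSpace X] (α : X ≃ₜ X) (n : ℤ) :
    α.toEquiv ^ n = (α ^ n).toEquiv :=
  (map_zpow (⟨⟨Homeomorph.toEquiv, rfl⟩, fun _ _ => rfl⟩ : (X ≃ₜ X) →* Equiv.Perm X) α n).symm

theorem toEquiv_pow {X : Type*} [TopologicalSpace X] (α : X ≃ₜ X) (n : ℕ) :
    α.toEquiv ^ n = (α ^ n).toEquiv := by
  simpa using toEquiv_zpow α n

theorem isClopen_preimage_pow {X : Type*} [TopologicalSpace X] (α : X ≃ₜ X) {Y : Set X}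
    (hY : IsClopen Y) (n : ℕ) : IsClopen {x | (α.toEquiv ^ n) x ∈ Y} := by
  rw [toEquiv_pow]
  exact hY.preimage (α ^ n).continuous

theorem isClopen_image_pow {X : Type*} [TopologicalSpace X] (α : X ≃ₜ X) {Y : Set X}
    (hY : IsClopen Y) (n : ℕ) : IsClopen ((α.toEquiv ^ n) '' Y) := by
  rw [toEquiv_pow]
  exact ⟨(α ^ n).isClosedMap _ hY.1, (α ^ n).isOpenMap _ hY.2⟩

/-- A point of `Y` lies in `Y_r` exactly when it is in `Y` at time `r` and at no time in between. -/
theorem mem_returnSet_iff {X : Type*} [TopologicalSpace X] (α : X ≃ₜ X) (Y : Set X) {r : ℕ}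
    (hr : 1 ≤ r) (y : X) :
    y ∈ returnSet α Y r ↔
      y ∈ Y ∧ (α.toEquiv ^ r) y ∈ Y ∧ ∀ n, 1 ≤ n → n < r → (α.toEquiv ^ n) y ∉ Y := by
  constructor
  · rintro ⟨hy, rfl⟩
    refine ⟨hy, (Nat.sInf_mem (Nat.nonempty_of_pos_sInf hr)).2, fun n hn hlt hmem => ?_⟩
    exact Nat.notMem_of_lt_sInf hlt ⟨hn, hmem⟩
  · rintro ⟨hy, hry, hmin⟩
    refine ⟨hy, le_antisymm (Nat.sInf_le ⟨hr, hry⟩) (le_csInf ⟨r, hr, hry⟩ ?_)⟩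
    rintro n ⟨hn, hmem⟩
    exact not_lt.mp fun hlt => hmin n hn hlt hmem

theorem isClopen_returnSet {X : Type*} [TopologicalSpace X] (α : X ≃ₜ X) {Y : Set X}
    (hY : IsClopen Y) {r : ℕ} (hr : 1 ≤ r) : IsClopen (returnSet α Y r) := by
  have heq : returnSet α Y r = Y ∩ ({x | (α.toEquiv ^ r) x ∈ Y} ∩
      ⋂ n ∈ Set.Ico 1 r, {x | (α.toEquiv ^ n) x ∈ Y}ᶜ) := by
    ext y
    simp [mem_returnSet_iff α Y hr]
  rw [heq]
  exact hY.inter ((isClopen_preimage_pow α hY r).inter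
    ((Set.finite_Ico 1 r).isClopen_biInter fun n _ => (isClopen_preimage_pow α hY n).compl))

/-- Under a minimal homeomorphism of a compact space, every orbit visits a non-empty open set
within a uniformly bounded time. -/
theorem exists_uniform_visit_bound {X : Type*} [TopologicalSpace X] [CompactSpace X]
    (α : X ≃ₜ X) (hmin : IsMinimalHomeo α) {U : Set X} (hU : IsOpen U) (hne : U.Nonempty) :
    ∃ M : ℕ, ∀ x : X, ∃ n : ℤ, |n| ≤ M ∧ (α.toEquiv ^ n) x ∈ U := by
  obtain ⟨t, ht⟩ := isCompact_univ.elim_finite_subcover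
    (fun n : ℤ => {x : X | (α.toEquiv ^ n) x ∈ U})
    (fun n => by
      rw [toEquiv_zpow]
      exact hU.preimage (α ^ n).continuous)
    (fun x _ => by
      obtain ⟨_, hxU, n, rfl⟩ := (hmin x).inter_open_nonempty U hU hne
      exact Set.mem_iUnion.mpr ⟨n, hxU⟩)
  refine ⟨t.sup Int.natAbs, fun x => ?_⟩
  obtain ⟨n, hn, hx⟩ := Set.mem_iUnion₂.mp (ht (Set.mem_univ x))
  refine ⟨n, ?_, hx⟩
  have : n.natAbs ≤ t.sup Int.natAbs := Finset.le_sup hn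
  rw [Int.abs_eq_natAbs]
  exact_mod_cast this

/-- Return times to a non-empty open set are uniformly bounded. -/
theorem exists_uniform_return_bound {X : Type*} [TopologicalSpace X] [CompactSpace X]
    (α : X ≃ₜ X) (hmin : IsMinimalHomeo α) {U : Set X} (hU : IsOpen U) (hne : U.Nonempty) :
    ∃ N : ℕ, ∀ x : X, ∃ n : ℕ, 1 ≤ n ∧ n ≤ N ∧ (α.toEquiv ^ n) x ∈ U := by
  obtain ⟨M, hM⟩ := exists_uniform_visit_bound α hmin hU hne
  refine ⟨2 * M + 1, fun x => ?_⟩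
  obtain ⟨n, hn, hx⟩ := hM ((α.toEquiv ^ ((M : ℤ) + 1)) x)
  rw [abs_le] at hn
  rw [← Equiv.Perm.mul_apply, ← zpow_add] at hx
  lift n + ((M : ℤ) + 1) to ℕ using (by omega) with k hk
  rw [zpow_natCast] at hx
  exact ⟨k, by omega, by omega, hx⟩

/-- Every point is in the forward orbit of every non-empty open set. -/
theorem exists_pow_apply_eq {X : Type*} [TopologicalSpace X] [CompactSpace X]
    (α : X ≃ₜ X) (hmin : IsMinimalHomeo α) {U : Set X} (hU : IsOpen U) (hne : U.Nonempty)
    (x : X) : ∃ m : ℕ, ∃ y ∈ U, (α.toEquiv ^ m) y = x := by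
  obtain ⟨M, hM⟩ := exists_uniform_visit_bound α hmin hU hne
  obtain ⟨n, hn, hx⟩ := hM ((α.toEquiv ^ (-(M : ℤ))) x)
  rw [abs_le] at hn
  rw [← Equiv.Perm.mul_apply, ← zpow_add] at hx
  refine ⟨((M : ℤ) - n).toNat, _, hx, ?_⟩
  rw [← zpow_natCast, Int.toNat_of_nonneg (by omega), ← Equiv.Perm.mul_apply, ← zpow_add]
  rw [show (M : ℤ) - n + (n + -M) = 0 by ring, zpow_zero, Equiv.Perm.one_apply]

/-- A point at level `i` of the tower over `Y_r` has not visited `Y` less than `i` steps earlier. -/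
theorem returnSet_level_le {X : Type*} [TopologicalSpace X] (α : X ≃ₜ X) {Y : Set X}
    {r i j : ℕ} (hir : i < r) {y z : X} (hy : y ∈ returnSet α Y r) (hz : z ∈ Y)
    (h : (α.toEquiv ^ i) y = (α.toEquiv ^ j) z) : i ≤ j := by
  by_contra! hji
  have hzy : (α.toEquiv ^ (i - j)) y = z := by
    apply (α.toEquiv ^ j).injective
    rw [← Equiv.Perm.mul_apply, ← pow_add, Nat.add_sub_cancel' hji.le, h]
  exact ((mem_returnSet_iff α Y (by omega) y).mp hy).2.2 (i - j) (by omega) (by omega) (hzy ▸ hz)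

/-- if `Y` is a non-empty clopen subset of `X` (closed and open with
non-empty interior), then each `Y_r = {y ∈ Y : r_Y(y) = r}` is clopen, `Y_r` is empty for
all but finitely many `r`, and the Rokhlin tower sets `α^i(Y_r)` (`r` a return time,
`0 ≤ i < r`) form a finite partition of `X` into clopen sets. -/
theorem clopen_rokhlin_partition {X : Type*} [MetricSpace X] [CompactSpace X]
    [Nonempty X] (α : X ≃ₜ X) (hmin : IsMinimalHomeo α) (Y : Set X)
    (hYclosed : IsClosed Y) (hYopen : IsOpen Y) (hYint : (interior Y).Nonempty) :
    (∀ r : ℕ, 1 ≤ r → IsClopen (returnSet α Y r)) ∧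
    {r : ℕ | 1 ≤ r ∧ (returnSet α Y r).Nonempty}.Finite ∧
    (∀ r i : ℕ, 1 ≤ r → i < r → IsClopen ((α.toEquiv ^ i) '' returnSet α Y r)) ∧
    (∀ x : X, ∃! p : ℕ × ℕ,
      1 ≤ p.1 ∧ p.2 < p.1 ∧ x ∈ (α.toEquiv ^ p.2) '' returnSet α Y p.1) := by
  have hY : IsClopen Y := ⟨hYclosed, hYopen⟩
  have hne : Y.Nonempty := hYint.mono interior_subset
  obtain ⟨N, hN⟩ := exists_uniform_return_bound α hmin hYopen hne
  refine ⟨fun r hr => isClopen_returnSet α hY hr, ?_,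
    fun r i hr _ => isClopen_image_pow α (isClopen_returnSet α hY hr) i, fun x => ?_⟩
  · refine (Set.finite_Iic N).subset ?_
    rintro r ⟨_, y, _, rfl⟩
    obtain ⟨n, hn1, hnN, hn⟩ := hN y
    have hle : firstReturn α Y y ≤ n := Nat.sInf_le ⟨hn1, hn⟩
    exact hle.trans hnN
  · classical
    have hex := exists_pow_apply_eq α hmin hYopen hne x
    obtain ⟨y, hy, hyx⟩ := Nat.find_spec hex
    set i := Nat.find hex
    obtain ⟨n, hn1, _, hn⟩ := hN y
    obtain ⟨hr1, hrY⟩ : firstReturn α Y y ∈ {n : ℕ | 1 ≤ n ∧ (α.toEquiv ^ n) y ∈ Y} :=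
      Nat.sInf_mem ⟨n, hn1, hn⟩
    have hir : i < firstReturn α Y y := by
      by_contra! hle
      refine Nat.find_min hex (m := i - firstReturn α Y y) (by omega) ⟨_, hrY, ?_⟩
      rw [← Equiv.Perm.mul_apply, ← pow_add, Nat.sub_add_cancel hle, hyx]
    refine ⟨(firstReturn α Y y, i), ⟨hr1, hir, y, ⟨hy, rfl⟩, hyx⟩, ?_⟩
    rintro ⟨s, j⟩ ⟨_, hjs, z, hz, hzx⟩
    dsimp only at hjs hz hzx
    have hyr : y ∈ returnSet α Y (firstReturn α Y y) := ⟨hy, rfl⟩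
    have hij : i = j := le_antisymm
      (returnSet_level_le α hir hyr hz.1 (hyx.trans hzx.symm))
      (returnSet_level_le α hjs hz hy (hzx.trans hyx.symm))
    subst hij
    obtain rfl : z = y := (α.toEquiv ^ i).injective (hzx.trans hyx.symm)
    rw [← hz.2]
end
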